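/- arXiv:1709.02507 — 2 statements merged into one kernel-verified Lean document; each statement's English description precedes it below -/
import Mathlib

section
/- Let p and ℓ be distinct primes and α an 𝔽̄_ℓ-valued measure on ℤ_p. Then α is supported on ℤ_p^× (i.e. α(U) = 0 for every compact open subset U ⊆ pℤ_p) if and only if Σ_{ε^p = 1} α̂(εζ) = 0 for every ζ ∈ μ_{p^∞}. -/
/-!
STATEMENT 2: For distinct primes `p, ℓ` and an `𝔽̄_ℓ`-valued measure `α` on `ℤ_p`,
`α` is supported on `ℤ_p^×` (i.e. `α(U) = 0` for every compact open `U ⊆ pℤ_p`)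
if and only if `∑_{ε^p = 1} α̂(εζ) = 0` for every `ζ ∈ μ_{p^∞}`.
-/

open scoped BigOperators Classical

/-- The coset `a + p^n ℤ_p` inside `ℤ_p`. -/
def padicCoset (p : ℕ) [Fact p.Prime] (a : ℤ_[p]) (n : ℕ) : Set ℤ_[p] :=
  {x : ℤ_[p] | ∃ y : ℤ_[p], x = a + (p : ℤ_[p]) ^ n * y}

/-- An `R`-valued measure on `ℤ_p`: a finitely additive `R`-valued function on
the compact open subsets of `ℤ_p`. -/
structure PadicMeasure (p : ℕ) [Fact p.Prime] (R : Type*) [AddCommMonoid R] where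
  toFun : Set ℤ_[p] → R
  additive : ∀ U V : Set ℤ_[p], IsCompact U → IsOpen U → IsCompact V → IsOpen V →
    Disjoint U V → toFun (U ∪ V) = toFun U + toFun V

/-- The Fourier transform `α̂(ζ) = ∫_{ℤ_p} ζ^x dα(x)` of a measure, computed at
level `n` (this is the honest value whenever `ζ ^ p ^ n = 1`). -/
noncomputable def fourierAt {p : ℕ} [Fact p.Prime] {R : Type*} [CommRing R]
    (α : PadicMeasure p R) (n : ℕ) (ζ : R) : R :=
  ∑ a ∈ Finset.range (p ^ n), ζ ^ a * α.toFun (padicCoset p (a : ℤ_[p]) n)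

lemma mem_padicCoset_iff {p : ℕ} [Fact p.Prime] {a x : ℤ_[p]} {n : ℕ} :
    x ∈ padicCoset p a n ↔ (p : ℤ_[p]) ^ n ∣ x - a := by
  constructor
  · rintro ⟨y, rfl⟩
    exact ⟨y, by ring⟩
  · rintro ⟨y, hy⟩
    exact ⟨y, by rw [← hy]; ring⟩

lemma nat_mem_padicCoset_iff {p : ℕ} [Fact p.Prime] {a b : ℕ} {n : ℕ} :
    (b : ℤ_[p]) ∈ padicCoset p (a : ℤ_[p]) n ↔ ((p : ℤ) ^ n ∣ (b : ℤ) - a) := by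
  rw [mem_padicCoset_iff, ← PadicInt.pow_p_dvd_int_iff]
  push_cast
  rfl

lemma padicCoset_eq_ball {p : ℕ} [Fact p.Prime] (a : ℤ_[p]) (n : ℕ) :
    padicCoset p a n = Metric.closedBall a ((p : ℝ) ^ (-n : ℤ)) := by
  ext x
  rw [mem_padicCoset_iff, Metric.mem_closedBall, dist_eq_norm,
    PadicInt.norm_le_pow_iff_mem_span_pow, Ideal.mem_span_singleton]

lemma padicCoset_isOpen {p : ℕ} [Fact p.Prime] (a : ℤ_[p]) (n : ℕ) :
    IsOpen (padicCoset p a n) := by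
  rw [padicCoset_eq_ball]
  apply IsUltrametricDist.isOpen_closedBall
  have : (0 : ℝ) < p := by exact_mod_cast (Fact.out : p.Prime).pos
  positivity

lemma padicCoset_isCompact {p : ℕ} [Fact p.Prime] (a : ℤ_[p]) (n : ℕ) :
    IsCompact (padicCoset p a n) := by
  rw [padicCoset_eq_ball]
  exact Metric.isClosed_closedBall.isCompact

lemma measure_empty' {p : ℕ} [Fact p.Prime] {R : Type*} [CommRing R] (α : PadicMeasure p R) :
    α.toFun ∅ = 0 := by
  have := α.additive ∅ ∅ isCompact_empty isOpen_empty isCompact_empty isOpen_empty (by simp)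
  simpa using this

lemma measure_biUnion {p : ℕ} [Fact p.Prime] {R : Type*} [CommRing R] (α : PadicMeasure p R)
    (n : ℕ) (s : Finset ℕ) (hs : ∀ a ∈ s, a < p ^ n) :
    α.toFun (⋃ a ∈ s, padicCoset p (a : ℤ_[p]) n) =
      ∑ a ∈ s, α.toFun (padicCoset p (a : ℤ_[p]) n) := by
  induction s using Finset.induction_on with
  | empty => simpa using measure_empty' α
  | insert b s hb ih =>
    rw [Finset.sum_insert hb, Finset.set_biUnion_insert, α.additive, ih]
    · exact fun a ha => hs a (Finset.mem_insert_of_mem ha)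
    · exact padicCoset_isCompact _ _
    · exact padicCoset_isOpen _ _
    · exact s.isCompact_biUnion fun _ _ => padicCoset_isCompact _ _
    · exact isOpen_biUnion fun _ _ => padicCoset_isOpen _ _
    · rw [Set.disjoint_left]
      intro x hx hx'
      simp only [Set.mem_iUnion] at hx'
      obtain ⟨c, hc, hx'⟩ := hx'
      rw [mem_padicCoset_iff] at hx hx'
      have h3 := dvd_sub hx hx'
      have h4 : (p : ℤ_[p]) ^ n ∣ (c : ℤ_[p]) - b := by
        convert h3 using 1; ring
      rw [← mem_padicCoset_iff, nat_mem_padicCoset_iff] at h4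
      have h5 := hs b (Finset.mem_insert_self _ _)
      have h6 := hs c (Finset.mem_insert_of_mem hc)
      have h7 : (c : ℤ) - b = 0 := by
        apply Int.eq_zero_of_abs_lt_dvd h4
        rw [abs_lt]
        zify at h5 h6
        constructor <;> linarith [Int.natCast_nonneg b, Int.natCast_nonneg c]
      have : c = b := by omega
      exact hb (this ▸ hc)

lemma measure_decomp {p : ℕ} [Fact p.Prime] {R : Type*} [CommRing R] (α : PadicMeasure p R)
    (n : ℕ) (U : Set ℤ_[p]) (hU : ∀ x ∈ U, ∀ y, x + (p : ℤ_[p]) ^ n * y ∈ U) :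
    α.toFun U = ∑ a ∈ (Finset.range (p ^ n)).filter (fun a : ℕ => (a : ℤ_[p]) ∈ U),
      α.toFun (padicCoset p (a : ℤ_[p]) n) := by
  rw [← measure_biUnion α n _ (by intro a ha; simpa using (Finset.mem_filter.1 ha).1)]
  congr 1
  ext x
  simp only [Set.mem_iUnion, Finset.mem_filter, Finset.mem_range]
  constructor
  · intro hx
    have h := PadicInt.appr_spec n x
    rw [Ideal.mem_span_singleton] at h
    refine ⟨x.appr n, ⟨PadicInt.appr_lt x n, ?_⟩, mem_padicCoset_iff.2 h⟩
    obtain ⟨y, hy⟩ := h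
    have := hU x hx (-y)
    convert this using 1
    rw [mul_neg, ← hy]; ring
  · rintro ⟨a, ⟨_, ha⟩, y, rfl⟩
    exact hU _ ha y

lemma exists_level {p : ℕ} [Fact p.Prime] (U : Set ℤ_[p]) (hc : IsCompact U) (ho : IsOpen U) :
    ∃ n : ℕ, ∀ x ∈ U, ∀ y, x + (p : ℤ_[p]) ^ n * y ∈ U := by
  obtain ⟨δ, hδ, h⟩ := hc.exists_thickening_subset_open ho subset_rfl
  obtain ⟨n, hn⟩ := PadicInt.exists_pow_neg_lt p hδ
  refine ⟨n, fun x hx y => h ?_⟩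
  rw [Metric.mem_thickening_iff]
  refine ⟨x, hx, lt_of_le_of_lt ?_ hn⟩
  rw [dist_eq_norm, PadicInt.norm_le_pow_iff_mem_span_pow, Ideal.mem_span_singleton]
  exact ⟨y, by ring⟩

lemma sum_roots {K : Type*} [Field K] [IsAlgClosed K] (N : ℕ) (hN : (N : K) ≠ 0) (a : ℕ) :
    ∑ ε ∈ (Polynomial.nthRoots N (1 : K)).toFinset, ε ^ a = if N ∣ a then (N : K) else 0 := by
  haveI : NeZero (N : K) := ⟨hN⟩
  have hN0 : 0 < N := Nat.pos_of_ne_zero (by rintro rfl; simp at hN)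
  haveI : NeZero N := ⟨hN0.ne'⟩
  obtain ⟨ω, hω⟩ := HasEnoughRootsOfUnity.exists_primitiveRoot K N
  have hmem : ∀ x : K, x ∈ (Polynomial.nthRoots N (1 : K)).toFinset ↔ x ^ N = 1 := by
    intro x
    rw [Multiset.mem_toFinset, Polynomial.mem_nthRoots hN0]
  split_ifs with h
  · obtain ⟨k, rfl⟩ := h
    rw [Finset.sum_congr rfl (g := fun _ => (1 : K))]
    · have : (Polynomial.nthRoots N (1 : K)).toFinset.card = N := by
        rw [Multiset.toFinset_card_of_nodup hω.nthRoots_one_nodup, hω.card_nthRoots_one]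
      simp [this]
    · intro x hx
      rw [pow_mul, (hmem x).1 hx, one_pow]
  · have hne : ω ^ a ≠ 1 := fun h' => h (hω.dvd_of_pow_eq_one _ h')
    have hω0 : ω ≠ 0 := hω.ne_zero hN0.ne'
    set S := ∑ ε ∈ (Polynomial.nthRoots N (1 : K)).toFinset, ε ^ a with hS
    have key : ω ^ a * S = S := by
      rw [hS, Finset.mul_sum]
      refine Finset.sum_nbij' (fun x => ω * x) (fun x => ω⁻¹ * x) ?_ ?_ ?_ ?_ ?_
      · intro x hx
        rw [hmem] at *
        rw [mul_pow, hx, hω.pow_eq_one, one_mul]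
      · intro x hx
        rw [hmem] at *
        rw [mul_pow, hx, inv_pow, hω.pow_eq_one, inv_one, one_mul]
      · intro x _; field_simp
      · intro x _; field_simp
      · intro x _; rw [mul_pow]
    have : (ω ^ a - 1) * S = 0 := by rw [sub_mul, key, one_mul, sub_self]
    exact (mul_eq_zero.1 this).resolve_left (sub_ne_zero.2 hne)

lemma sum_fourier {p : ℕ} [Fact p.Prime] {K : Type*} [Field K] [IsAlgClosed K]
    (hp : (p : K) ≠ 0) (α : PadicMeasure p K) (n : ℕ) (ζ : K) :
    ∑ ε ∈ (Polynomial.nthRoots p (1 : K)).toFinset, fourierAt α n (ε * ζ) =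
    ∑ a ∈ Finset.range (p ^ n), (if p ∣ a then (p : K) else 0) *
      (ζ ^ a * α.toFun (padicCoset p (a : ℤ_[p]) n)) := by
  unfold fourierAt
  rw [Finset.sum_comm]
  refine Finset.sum_congr rfl fun a _ => ?_
  rw [← sum_roots p hp a, Finset.sum_mul]
  refine Finset.sum_congr rfl fun ε _ => ?_
  rw [mul_pow]; ring

lemma coset_zero {p : ℕ} [Fact p.Prime] {K : Type*} [Field K] [IsAlgClosed K]
    (hp : (p : K) ≠ 0) (α : PadicMeasure p K) (n : ℕ) (hn : n ≠ 0)
    (h : ∀ ζ : K, ζ ^ p ^ n = 1 →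
      ∑ ε ∈ (Polynomial.nthRoots p (1 : K)).toFinset, fourierAt α (n + 1) (ε * ζ) = 0)
    (a : ℕ) (ha : a < p ^ n) (hpa : p ∣ a) :
    α.toFun (padicCoset p (a : ℤ_[p]) n) = 0 := by
  have hN : ((p ^ n : ℕ) : K) ≠ 0 := by push_cast; exact pow_ne_zero _ hp
  have hN0 : 0 < p ^ n := pow_pos (Fact.out : p.Prime).pos n
  have h1 : ∑ ζ ∈ (Polynomial.nthRoots (p ^ n) (1 : K)).toFinset, ζ ^ (p ^ n - a) *
      ∑ b ∈ Finset.range (p ^ (n + 1)), (if p ∣ b then (p : K) else 0) *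
      (ζ ^ b * α.toFun (padicCoset p (b : ℤ_[p]) (n + 1))) = 0 := by
    refine Finset.sum_eq_zero fun ζ hζ => ?_
    rw [Multiset.mem_toFinset, Polynomial.mem_nthRoots hN0] at hζ
    rw [← sum_fourier hp, h ζ hζ, mul_zero]
  simp_rw [Finset.mul_sum] at h1
  rw [Finset.sum_comm] at h1
  have h2 : ∀ b ∈ Finset.range (p ^ (n + 1)),
      ∑ ζ ∈ (Polynomial.nthRoots (p ^ n) (1 : K)).toFinset, ζ ^ (p ^ n - a) *
        ((if p ∣ b then (p : K) else 0) *
        (ζ ^ b * α.toFun (padicCoset p (b : ℤ_[p]) (n + 1)))) =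
      if (b : ℤ_[p]) ∈ padicCoset p (a : ℤ_[p]) n then
        ((p : K) * ((p ^ n : ℕ) : K)) * α.toFun (padicCoset p (b : ℤ_[p]) (n + 1)) else 0 := by
    intro b _
    have e : ∑ ζ ∈ (Polynomial.nthRoots (p ^ n) (1 : K)).toFinset, ζ ^ (p ^ n - a) *
        ((if p ∣ b then (p : K) else 0) *
        (ζ ^ b * α.toFun (padicCoset p (b : ℤ_[p]) (n + 1)))) =
        (∑ ζ ∈ (Polynomial.nthRoots (p ^ n) (1 : K)).toFinset, ζ ^ (p ^ n - a + b)) *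
        ((if p ∣ b then (p : K) else 0) * α.toFun (padicCoset p (b : ℤ_[p]) (n + 1))) := by
      rw [Finset.sum_mul]
      refine Finset.sum_congr rfl fun ζ _ => ?_
      rw [pow_add]; ring
    rw [e, sum_roots _ hN]
    have hiff : p ^ n ∣ p ^ n - a + b ↔ (b : ℤ_[p]) ∈ padicCoset p (a : ℤ_[p]) n := by
      rw [nat_mem_padicCoset_iff, ← Int.natCast_dvd_natCast]
      push_cast [Nat.cast_sub ha.le]
      rw [show (p : ℤ) ^ n - a + b = p ^ n + (b - a) by ring, dvd_add_right dvd_rfl]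
    by_cases hb : p ^ n ∣ p ^ n - a + b
    · have hpn : p ∣ p ^ n := dvd_pow_self p hn
      have hpb : p ∣ b := (Nat.dvd_add_right (Nat.dvd_sub hpn hpa)).1 (hpn.trans hb)
      rw [if_pos hb, if_pos (hiff.1 hb), if_pos hpb]; ring
    · rw [if_neg hb, if_neg (fun h' => hb (hiff.2 h')), zero_mul]
  rw [Finset.sum_congr rfl h2, ← Finset.sum_filter, ← Finset.mul_sum, ← measure_decomp] at h1
  · exact (mul_eq_zero.1 h1).resolve_left (mul_ne_zero hp hN)
  · rintro x ⟨z, rfl⟩ y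
    exact ⟨z + p * y, by ring⟩

theorem supported_on_units_iff_fourier (p ℓ : ℕ) [Fact p.Prime] [Fact ℓ.Prime] (hpl : p ≠ ℓ)
    (α : PadicMeasure p (AlgebraicClosure (ZMod ℓ))) :
    (∀ U : Set ℤ_[p], IsCompact U → IsOpen U → U ⊆ {x : ℤ_[p] | (p : ℤ_[p]) ∣ x} →
        α.toFun U = 0) ↔
    (∀ (n : ℕ) (ζ : AlgebraicClosure (ZMod ℓ)), ζ ^ p ^ n = 1 →
        ∑ ε ∈ (Polynomial.nthRoots p (1 : AlgebraicClosure (ZMod ℓ))).toFinset,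
          fourierAt α (n + 1) (ε * ζ) = 0) := by
  have hp : (p : AlgebraicClosure (ZMod ℓ)) ≠ 0 := by
    intro h0
    rw [CharP.cast_eq_zero_iff (AlgebraicClosure (ZMod ℓ)) ℓ] at h0
    exact hpl ((Nat.prime_dvd_prime_iff_eq Fact.out Fact.out).1 h0).symm
  constructor
  · intro h n ζ _
    rw [sum_fourier hp]
    refine Finset.sum_eq_zero fun a _ => ?_
    split_ifs with hpa
    · rw [h _ (padicCoset_isCompact _ _) (padicCoset_isOpen _ _)]
      · simp
      · rintro x ⟨y, rfl⟩
        exact dvd_add (Nat.cast_dvd_cast hpa)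
          (Dvd.dvd.mul_right (dvd_pow_self _ (Nat.succ_ne_zero n)) y)
    · simp
  · intro h U hc ho hU
    obtain ⟨n, hn⟩ := exists_level U hc ho
    rw [measure_decomp α (n + 1) U]
    · refine Finset.sum_eq_zero fun a ha => ?_
      rw [Finset.mem_filter, Finset.mem_range] at ha
      refine coset_zero hp α (n + 1) (Nat.succ_ne_zero n) (h (n + 1)) a ha.1 ?_
      have h1 : (p : ℤ_[p]) ∣ a := hU ha.2
      have h2 := (PadicInt.pow_p_dvd_int_iff (p := p) 1 (a : ℤ)).1 (by simpa using h1)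
      exact_mod_cast (by simpa using h2 : (p : ℤ) ∣ (a : ℤ))
    · intro x hx y
      have := hn x hx (p * y)
      rwa [← mul_assoc, ← pow_succ] at this
end

section
/- Let θ be a Dirichlet character of conductor f_θ, p a prime, f = 2p·f_θ, and k ≥ 0 an integer. Then Σ_{ε^p = 1} R_k(εZ) = 0 as rational functions, where the sum is over all p-th roots of unity ε. -/
/-!
STATEMENT 8: Let `θ` be a Dirichlet character of conductor `f_θ`, `p` a prime,
`f = 2p f_θ`, `k ≥ 0`, and
`R_k(Z) = D^k((∑_{1≤a≤f, p∤a} θ(a) Z^a)/(1 - Z^f))` with `D = Z d/dZ`.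
Then `∑_{ε^p = 1} R_k(εZ) = 0` as rational functions.
-/

open scoped BigOperators Classical

/-- The operator `D = Z d/dZ` on rational functions. -/
noncomputable def Dop {K : Type*} [Field K] (R : RatFunc K) : RatFunc K :=
  RatFunc.X * (algebraMap (Polynomial K) (RatFunc K)
      (Polynomial.derivative R.num * R.denom - R.num * Polynomial.derivative R.denom) /
    algebraMap (Polynomial K) (RatFunc K) (R.denom ^ 2))

/-- The substitution `Z ↦ εZ` on rational functions. -/
noncomputable def ratScale {K : Type*} [Field K] (ε : K) (R : RatFunc K) : RatFunc K :=
  algebraMap (Polynomial K) (RatFunc K) (R.num.comp (Polynomial.C ε * Polynomial.X)) /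
    algebraMap (Polynomial K) (RatFunc K) (R.denom.comp (Polynomial.C ε * Polynomial.X))

/-- `R_k(Z) = D^k((∑_{1≤a≤2pf_θ, p∤a} θ(a) Z^a)/(1 - Z^{2pf_θ}))`. -/
noncomputable def Rk {K : Type*} [Field K] {fθ : ℕ} (θ : DirichletCharacter K fθ)
    (p k : ℕ) : RatFunc K :=
  Dop^[k] ((∑ a ∈ (Finset.Icc 1 (2 * p * fθ)).filter (fun a => ¬ p ∣ a),
      RatFunc.C (θ (a : ZMod fθ)) * RatFunc.X ^ a) /
    (1 - RatFunc.X ^ (2 * p * fθ)))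

open Polynomial in
lemma aux_cross {K : Type*} [Field K] (A B : K[X]) (hB : B ≠ 0) (R : RatFunc K)
    (hR : R = algebraMap K[X] (RatFunc K) A / algebraMap K[X] (RatFunc K) B) :
    R.num * B = A * R.denom := by
  have hd := R.denom_ne_zero
  have h := R.num_div_denom.trans hR
  rw [div_eq_div_iff (RatFunc.algebraMap_ne_zero hd) (RatFunc.algebraMap_ne_zero hB),
    ← map_mul, ← map_mul] at h
  exact RatFunc.algebraMap_injective K h

open Polynomial in
lemma aux_Dop {K : Type*} [Field K] (A B : K[X]) (hB : B ≠ 0) (R : RatFunc K)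
    (hR : R = algebraMap K[X] (RatFunc K) A / algebraMap K[X] (RatFunc K) B) :
    Dop R = algebraMap K[X] (RatFunc K)
      ((X * derivative A) * B - A * (X * derivative B)) /
      algebraMap K[X] (RatFunc K) (B ^ 2) := by
  have h := aux_cross A B hB R hR
  have hd := R.denom_ne_zero
  have h' := congrArg derivative h
  simp only [derivative_mul] at h'
  unfold Dop
  rw [← RatFunc.algebraMap_X, ← mul_div_assoc, ← map_mul,
    div_eq_div_iff (RatFunc.algebraMap_ne_zero (pow_ne_zero 2 hd))
      (RatFunc.algebraMap_ne_zero (pow_ne_zero 2 hB)), ← map_mul, ← map_mul]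
  congr 1
  generalize R.num = n at *
  generalize R.denom = d at *
  generalize derivative n = n' at *
  generalize derivative d = d' at *
  generalize derivative A = A' at *
  generalize derivative B = B' at *
  linear_combination (X * d * B) * h' - (X * d' * B + X * d * B') * h

open Polynomial in
lemma aux_scale {K : Type*} [Field K] (ε : K) (hε : ε ≠ 0) (A B : K[X]) (hB : B ≠ 0)
    (R : RatFunc K)
    (hR : R = algebraMap K[X] (RatFunc K) A / algebraMap K[X] (RatFunc K) B) :
    ratScale ε R = algebraMap K[X] (RatFunc K) (A.comp (C ε * X)) /
      algebraMap K[X] (RatFunc K) (B.comp (C ε * X)) := by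
  have h := aux_cross A B hB R hR
  have hd := R.denom_ne_zero
  have key : ∀ q : K[X], q ≠ 0 → q.comp (C ε * X) ≠ 0 := by
    intro q hq h0
    apply hq
    have : (q.comp (C ε * X)).comp (C ε⁻¹ * X) = q := by
      rw [comp_assoc]
      have : (C ε * X).comp (C ε⁻¹ * X) = (X : K[X]) := by
        simp only [mul_comp, C_comp, X_comp]
        rw [← mul_assoc, ← C_mul, mul_inv_cancel₀ hε]; simp
      rw [this, comp_X]
    rw [← this, h0, zero_comp]
  unfold ratScale
  rw [div_eq_div_iff (RatFunc.algebraMap_ne_zero (key _ hd))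
      (RatFunc.algebraMap_ne_zero (key _ hB)), ← map_mul, ← map_mul, ← mul_comp, ← mul_comp, h]

open Polynomial in
def GoodRat {K : Type*} [Field K] (s : Finset K) (R : RatFunc K) : Prop :=
  ∃ A B : K[X], B ≠ 0 ∧ R = algebraMap K[X] (RatFunc K) A / algebraMap K[X] (RatFunc K) B ∧
    (∀ ε ∈ s, B.comp (C ε * X) = B) ∧ ∑ ε ∈ s, A.comp (C ε * X) = 0

open Polynomial in
lemma aux_delta {K : Type*} [Field K] (ε : K) (A : K[X]) :
    (X * derivative A).comp (C ε * X) = X * derivative (A.comp (C ε * X)) := by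
  rw [derivative_comp]
  simp
  ring

open Polynomial in
lemma GoodRat.dop {K : Type*} [Field K] {s : Finset K} {R : RatFunc K} (h : GoodRat s R) :
    GoodRat s (Dop R) := by
  obtain ⟨A, B, hB, hR, h1, h2⟩ := h
  refine ⟨_, _, pow_ne_zero 2 hB, aux_Dop A B hB R hR, ?_, ?_⟩
  · intro ε hε
    rw [pow_comp, h1 ε hε]
  · have : ∀ ε ∈ s, (X * derivative A * B - A * (X * derivative B)).comp (C ε * X) =
        X * derivative (A.comp (C ε * X)) * B - A.comp (C ε * X) * (X * derivative B) := by
      intro ε hε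
      rw [sub_comp, mul_comp, mul_comp A, aux_delta, aux_delta, h1 ε hε]
    rw [Finset.sum_congr rfl this, Finset.sum_sub_distrib, ← Finset.sum_mul, ← Finset.sum_mul,
      ← Finset.mul_sum, ← derivative_sum, h2]
    simp

lemma GoodRat.sum {K : Type*} [Field K] {s : Finset K} (hs : ∀ ε ∈ s, ε ≠ 0)
    {R : RatFunc K} (h : GoodRat s R) : ∑ ε ∈ s, ratScale ε R = 0 := by
  obtain ⟨A, B, hB, hR, h1, h2⟩ := h
  have : ∀ ε ∈ s, ratScale ε R =
      algebraMap (Polynomial K) (RatFunc K) (A.comp (Polynomial.C ε * Polynomial.X)) /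
        algebraMap (Polynomial K) (RatFunc K) B := fun ε hε => by
    have := aux_scale ε (hs ε hε) A B hB R hR
    rw [h1 ε hε] at this
    exact this
  rw [Finset.sum_congr rfl this, ← Finset.sum_div, ← map_sum, h2]
  simp

lemma aux_powsum {K : Type*} [Field K] [IsAlgClosed K] [CharZero K] (p : ℕ) [Fact p.Prime]
    (a : ℕ) (ha : ¬ p ∣ a) :
    ∑ ε ∈ (Polynomial.nthRoots p (1 : K)).toFinset, ε ^ a = 0 := by
  have hp : 0 < p := (Fact.out : p.Prime).pos
  have : NeZero (p : K) := ⟨by exact_mod_cast hp.ne'⟩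
  obtain ⟨ζ, hζ⟩ := HasEnoughRootsOfUnity.exists_primitiveRoot K p
  have hne : ζ ^ a ≠ 1 := fun h => ha (hζ.dvd_of_pow_eq_one a h)
  have hz : ζ ≠ 0 := hζ.ne_zero hp.ne'
  have key : ∑ ε ∈ (Polynomial.nthRoots p (1 : K)).toFinset, (ζ * ε) ^ a =
      ∑ ε ∈ (Polynomial.nthRoots p (1 : K)).toFinset, ε ^ a := by
    refine Finset.sum_bij' (fun ε _ => ζ * ε) (fun ε _ => ζ⁻¹ * ε) ?_ ?_ ?_ ?_ ?_
    · intro ε hε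
      simp only [Multiset.mem_toFinset, Polynomial.mem_nthRoots hp] at hε ⊢
      rw [mul_pow, hζ.pow_eq_one, hε, one_mul]
    · intro ε hε
      simp only [Multiset.mem_toFinset, Polynomial.mem_nthRoots hp] at hε ⊢
      rw [mul_pow, inv_pow, hζ.pow_eq_one, hε, inv_one, one_mul]
    · intro ε _; field_simp
    · intro ε _; field_simp
    · intro ε _; rfl
  simp only [mul_pow] at key
  rw [← Finset.mul_sum] at key
  have : (ζ ^ a - 1) * ∑ ε ∈ (Polynomial.nthRoots p (1 : K)).toFinset, ε ^ a = 0 := by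
    rw [sub_mul, key]; ring
  exact (mul_eq_zero.mp this).resolve_left (sub_ne_zero.mpr hne)

theorem sum_Rk_scaled_by_pth_roots_eq_zero {K : Type*} [Field K] [IsAlgClosed K]
    [CharZero K] (p : ℕ) [Fact p.Prime] {fθ : ℕ}
    (θ : DirichletCharacter K fθ) (hθprim : θ.IsPrimitive) (k : ℕ) :
    ∑ ε ∈ (Polynomial.nthRoots p (1 : K)).toFinset, ratScale ε (Rk θ p k) = 0 := by
  have hp : 0 < p := (Fact.out : p.Prime).pos
  have hs : ∀ ε ∈ (Polynomial.nthRoots p (1 : K)).toFinset, ε ^ p = 1 := by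
    intro ε hε
    simpa only [Multiset.mem_toFinset, Polynomial.mem_nthRoots hp] using hε
  apply GoodRat.sum
  · intro ε hε h0
    have := hs ε hε
    rw [h0, zero_pow hp.ne'] at this
    exact zero_ne_one this
  unfold Rk
  induction k with
  | succ k ih => rw [Function.iterate_succ_apply']; exact ih.dop
  | zero =>
    rw [Function.iterate_zero_apply]
    rcases Nat.eq_zero_or_pos fθ with h0 | h0
    · refine ⟨0, 1, one_ne_zero, ?_, ?_, ?_⟩
      · have : 2 * p * fθ = 0 := by rw [h0, mul_zero]
        rw [this]; simp
      · simp
      · simp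
    · refine ⟨∑ a ∈ (Finset.Icc 1 (2 * p * fθ)).filter (fun a => ¬ p ∣ a),
        Polynomial.C (θ (a : ZMod fθ)) * Polynomial.X ^ a,
        1 - Polynomial.X ^ (2 * p * fθ), ?_, ?_, ?_, ?_⟩
      · intro h
        have h2 := congrArg (Polynomial.eval 0) h
        have : 2 * p * fθ ≠ 0 := by positivity
        simp [this] at h2
      · simp
      · intro ε hε
        have : ε ^ (2 * p * fθ) = 1 := by
          rw [show 2 * p * fθ = p * (2 * fθ) by ring, pow_mul, hs ε hε, one_pow]
        simp [mul_pow, ← Polynomial.C_pow, this]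
      · simp only [Polynomial.sum_comp]
        rw [Finset.sum_comm]
        refine Finset.sum_eq_zero fun a ha => ?_
        have := aux_powsum (K := K) p a (Finset.mem_filter.mp ha).2
        simp only [Polynomial.mul_comp, Polynomial.C_comp, Polynomial.pow_comp,
          Polynomial.X_comp, mul_pow, ← Polynomial.C_pow]
        rw [← Finset.mul_sum, ← Finset.sum_mul, ← map_sum, this]
        simp
end
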